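/- The triple (Cof, Fib, W) = (All, Iso ∪ Empty, Iso ∪ NonEmpty) is a model structure on the category Set of sets: the cofibrations are all set maps, the fibrations are the set maps that are bijections or have empty domain, and the weak equivalences are the set maps that are bijections or have nonempty domain. -/

import Mathlib

universe u

/-- A class of morphisms of the category `Set` of sets. -/
abbrev MapClass : Type (u + 1) := ∀ (X Y : Type u), (X → Y) → Prop

/-- `i` has the left lifting property (LLP) with respect to `p`
(equivalently, `p` has the right lifting property (RLP) with respect to `i`):
every commutative square `p ∘ α = β ∘ i` admits a diagonal filler `g`. -/
def LiftSq {A B X Y : Type u} (i : A → B) (p : X → Y) : Prop :=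
  ∀ (α : A → X) (β : B → Y), p ∘ α = β ∘ i →
    ∃ g : B → X, g ∘ i = α ∧ p ∘ g = β

/-- `All`: the class of all set maps. -/
def AllMaps : MapClass.{u} := fun _ _ _ => True

/-- `Iso`: the class of bijections. -/
def IsoMaps : MapClass.{u} := fun _ _ f => Function.Bijective f

/-- `Mono`: the class of injections. -/
def MonoMaps : MapClass.{u} := fun _ _ f => Function.Injective f

/-- `Epi`: the class of surjections. -/
def EpiMaps : MapClass.{u} := fun _ _ f => Function.Surjective f

/-- `SplitMono`: the class of set maps having a left inverse. -/
def SplitMonoMaps : MapClass.{u} := fun X Y f => ∃ g : Y → X, g ∘ f = id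

/-- `Empty`: the class of set maps whose domain is empty. -/
def EmptyMaps : MapClass.{u} := fun X _Y _f => IsEmpty X

/-- `NonEmpty`: the class of set maps whose domain is nonempty. -/
def NonEmptyMaps : MapClass.{u} := fun X _Y _f => Nonempty X

/-- The union of two classes of set maps. -/
def unionMaps (P Q : MapClass.{u}) : MapClass.{u} := fun X Y f => P X Y f ∨ Q X Y f

/-- `(L, R)` is a weak factorization system on the category of sets:
`L` is exactly the class of maps having the LLP with respect to every member of `R`,
`R` is exactly the class of maps having the RLP with respect to every member of `L`,
and every set map factors as `r ∘ l` with `l ∈ L` and `r ∈ R`. -/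
structure IsWFS (L R : MapClass.{u}) : Prop where
  left_iff : ∀ {A B : Type u} (i : A → B),
    L A B i ↔ ∀ {X Y : Type u} (p : X → Y), R X Y p → LiftSq i p
  right_iff : ∀ {X Y : Type u} (p : X → Y),
    R X Y p ↔ ∀ {A B : Type u} (i : A → B), L A B i → LiftSq i p
  factor : ∀ {X Y : Type u} (f : X → Y),
    ∃ (Z : Type u) (l : X → Z) (r : Z → Y), L X Z l ∧ R Z Y r ∧ r ∘ l = f

/-- `f` is a retract of `g` in the arrow category of `Set`. -/
def IsRetract {X Y Z W : Type u} (f : X → Y) (g : Z → W) : Prop :=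
  ∃ (i : X → Z) (p : Z → X) (j : Y → W) (q : W → Y),
    p ∘ i = id ∧ q ∘ j = id ∧ g ∘ i = j ∘ f ∧ q ∘ g = f ∘ p

/-- `(Cof, Fib, W)` is a model structure on the category of sets: `W` is closed under
retracts and satisfies the two-out-of-three axiom, and both `(Cof ∩ W, Fib)` and
`(Cof, Fib ∩ W)` are weak factorization systems. -/
structure IsModelStructure (Cof Fib W : MapClass.{u}) : Prop where
  weq_retract : ∀ {X Y Z T : Type u} (f : X → Y) (g : Z → T),
    IsRetract f g → W Z T g → W X Y f
  weq_comp : ∀ {X Y Z : Type u} (f : X → Y) (g : Y → Z),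
    W X Y f → W Y Z g → W X Z (g ∘ f)
  weq_of_comp_left : ∀ {X Y Z : Type u} (f : X → Y) (g : Y → Z),
    W X Y f → W X Z (g ∘ f) → W Y Z g
  weq_of_comp_right : ∀ {X Y Z : Type u} (f : X → Y) (g : Y → Z),
    W Y Z g → W X Z (g ∘ f) → W X Y f
  wfs_trivCof_fib : IsWFS (fun X Y f => Cof X Y f ∧ W X Y f) Fib
  wfs_cof_trivFib : IsWFS Cof (fun X Y f => Fib X Y f ∧ W X Y f)

open Function

theorem unionMaps_iso_nonEmpty_iff {X Y : Type u} {f : X → Y} :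
    unionMaps IsoMaps NonEmptyMaps X Y f ↔ (Nonempty Y → Nonempty X) := by
  constructor
  · rintro (h | h) ⟨y⟩
    · exact ⟨(h.surjective y).choose⟩
    · exact h
  · intro h
    rcases isEmpty_or_nonempty X with hX | hX
    · exact Or.inl ⟨fun x => hX.elim x, fun y => hX.elim (h ⟨y⟩).some⟩
    · exact Or.inr hX

theorem isoOrEmpty_and_isoOrNonEmpty_iff {X Y : Type u} {f : X → Y} :
    (unionMaps IsoMaps EmptyMaps X Y f ∧ unionMaps IsoMaps NonEmptyMaps X Y f) ↔
      Bijective f := by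
  constructor
  · rintro ⟨h | h, h' | h'⟩
    · exact h
    · exact h
    · exact h'
    · exact (not_nonempty_iff.2 h h').elim
  · exact fun h => ⟨Or.inl h, Or.inl h⟩

theorem liftSq_of_bijective_right {A B X Y : Type u} (i : A → B) {p : X → Y}
    (hp : Bijective p) : LiftSq i p := by
  obtain ⟨q, hqp, hpq⟩ := bijective_iff_has_inverse.1 hp
  refine fun α β h => ⟨q ∘ β, ?_, ?_⟩
  · rw [comp_assoc, ← h, ← comp_assoc, hqp.comp_eq_id, id_comp]
  · rw [← comp_assoc, hpq.comp_eq_id, id_comp]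

theorem bijective_of_liftSq_self {X Y : Type u} {p : X → Y} (h : LiftSq p p) :
    Bijective p := by
  obtain ⟨g, hgp, hpg⟩ := h id id rfl
  exact bijective_iff_has_inverse.2 ⟨g, congrFun hgp, congrFun hpg⟩

theorem liftSq_of_isEmpty {A B X Y : Type u} (i : A → B) (p : X → Y) [IsEmpty X]
    (hi : Nonempty B → Nonempty A) : LiftSq i p := by
  intro α β _
  have hA : IsEmpty A := α.isEmpty
  have hB : IsEmpty B := not_nonempty_iff.1 fun h => not_nonempty_iff.2 hA (hi h)
  exact ⟨isEmptyElim, Subsingleton.elim _ _, Subsingleton.elim _ _⟩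

theorem isWFS_isoOrNonEmpty_isoOrEmpty :
    IsWFS.{u} (fun X Y f => AllMaps X Y f ∧ unionMaps IsoMaps NonEmptyMaps X Y f)
      (unionMaps IsoMaps EmptyMaps) := by
  have lift {A B X Y : Type u} (i : A → B) (p : X → Y)
      (hi : unionMaps IsoMaps NonEmptyMaps A B i) (hp : unionMaps IsoMaps EmptyMaps X Y p) :
      LiftSq i p := by
    rcases hp with hp | hp
    · exact liftSq_of_bijective_right i hp
    · have : IsEmpty X := hp
      exact liftSq_of_isEmpty i p (unionMaps_iso_nonEmpty_iff.1 hi)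
  refine ⟨fun {A B} i => ⟨fun hi _ _ p hp => lift i p hi.2 hp, fun h => ⟨trivial, ?_⟩⟩,
    fun {X Y} p => ⟨fun hp _ _ i hi => lift i p hi.2 hp, fun h => ?_⟩, fun {X Y} f => ?_⟩
  · rcases isEmpty_or_nonempty A with hA | hA
    · refine unionMaps_iso_nonEmpty_iff.2 fun ⟨b⟩ => ?_
      obtain ⟨g, -, -⟩ := h i (Or.inr hA) id id rfl
      exact ⟨g b⟩
    · exact Or.inr hA
  · rcases isEmpty_or_nonempty X with hX | hX
    · exact Or.inr hX
    · exact Or.inl (bijective_of_liftSq_self (h p ⟨trivial, Or.inr hX⟩))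
  · rcases isEmpty_or_nonempty X with hX | hX
    · exact ⟨X, id, f, ⟨trivial, Or.inl bijective_id⟩, Or.inr hX, rfl⟩
    · exact ⟨Y, f, id, ⟨trivial, Or.inr hX⟩, Or.inl bijective_id, rfl⟩

theorem isWFS_all_iso : IsWFS.{u} AllMaps IsoMaps where
  left_iff i := ⟨fun _ _ _ _ hp => liftSq_of_bijective_right i hp, fun _ => trivial⟩
  right_iff p := ⟨fun hp _ _ i _ => liftSq_of_bijective_right i hp,
    fun h => bijective_of_liftSq_self (h p trivial)⟩
  factor {_ Y} f := ⟨Y, f, id, trivial, bijective_id, rfl⟩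

/-- The triple `(All, Iso ∪ Empty, Iso ∪ NonEmpty)` is a model structure on the category of sets. -/
theorem all_isoOrEmpty_isoOrNonEmpty_isModelStructure :
    IsModelStructure.{u} (AllMaps) (unionMaps IsoMaps EmptyMaps) (unionMaps IsoMaps NonEmptyMaps) := by
  refine ⟨?_, ?_, ?_, ?_, isWFS_isoOrNonEmpty_isoOrEmpty, ?_⟩
  · rintro X Y Z T f g ⟨_, p, j, _, -⟩ hg
    rw [unionMaps_iso_nonEmpty_iff] at hg ⊢
    exact fun hY => (hg (hY.map j)).map p
  · intro X Y Z f g hf hg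
    rw [unionMaps_iso_nonEmpty_iff] at hf hg ⊢
    exact hf ∘ hg
  · intro X Y Z f g _ hgf
    rw [unionMaps_iso_nonEmpty_iff] at hgf ⊢
    exact fun hZ => (hgf hZ).map f
  · intro X Y Z f g _ hgf
    rw [unionMaps_iso_nonEmpty_iff] at hgf ⊢
    exact fun hY => hgf (hY.map g)
  · have h : (fun X Y f => unionMaps IsoMaps EmptyMaps X Y f ∧
        unionMaps IsoMaps NonEmptyMaps X Y f) = IsoMaps.{u} := by
      funext X Y f
      exact propext isoOrEmpty_and_isoOrNonEmpty_iff
    rw [h]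
    exact isWFS_all_iso
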